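/- For all x > 0 and y > 0, the first-order partial derivatives of the Black–Scholes put price are: ∂BS_Put/∂x (x,y) = −Φ(−d_+(x,y)) and ∂BS_Put/∂y (x,y) = x·φ(d_+(x,y))/(2·√y). -/

import Mathlib

/-- Density of the standard normal distribution. -/
noncomputable def stdGaussianPDF (z : ℝ) : ℝ :=
  (Real.sqrt (2 * Real.pi))⁻¹ * Real.exp (-z ^ 2 / 2)

/-- Cumulative distribution function of the standard normal distribution. -/
noncomputable def stdGaussianCDF (z : ℝ) : ℝ :=
  ∫ t in Set.Iic z, stdGaussianPDF t

/-- d₊ from the Black–Scholes formula. -/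
noncomputable def dPlus (K r T x y : ℝ) : ℝ :=
  (Real.log (x / K) + r * T + y / 2) / Real.sqrt y

/-- d₋ from the Black–Scholes formula. -/
noncomputable def dMinus (K r T x y : ℝ) : ℝ :=
  (Real.log (x / K) + r * T - y / 2) / Real.sqrt y

/-- Black–Scholes put price with strike `K`, interest rate `r`, maturity `T`,
spot `x` and integrated variance `y`. -/
noncomputable def BSPut (K r T x y : ℝ) : ℝ :=
  K * Real.exp (-(r * T)) * stdGaussianCDF (-(dMinus K r T x y)) -
    x * stdGaussianCDF (-(dPlus K r T x y))

theorem continuous_stdGaussianPDF : Continuous stdGaussianPDF := by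
  unfold stdGaussianPDF
  fun_prop

theorem integrable_stdGaussianPDF : MeasureTheory.Integrable stdGaussianPDF := by
  refine ((integrable_exp_neg_mul_sq (b := 1 / 2) (by norm_num)).const_mul
    (Real.sqrt (2 * Real.pi))⁻¹).congr (.of_forall fun z => ?_)
  simp only [stdGaussianPDF]
  ring_nf

theorem stdGaussianPDF_neg (z : ℝ) : stdGaussianPDF (-z) = stdGaussianPDF z := by
  simp [stdGaussianPDF]

theorem hasDerivAt_stdGaussianCDF (z : ℝ) :
    HasDerivAt stdGaussianCDF (stdGaussianPDF z) z := by
  have h : stdGaussianCDF = fun w => stdGaussianCDF 0 + ∫ t in (0 : ℝ)..w, stdGaussianPDF t := by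
    funext w
    rw [← intervalIntegral.integral_Iic_sub_Iic integrable_stdGaussianPDF.integrableOn
      integrable_stdGaussianPDF.integrableOn]
    simp [stdGaussianCDF]
  rw [h]
  exact (continuous_stdGaussianPDF.integral_hasStrictDerivAt 0 z).hasDerivAt.const_add _

theorem HasDerivAt.stdGaussianCDF_neg {d : ℝ → ℝ} {d' t : ℝ} (hd : HasDerivAt d d' t) :
    HasDerivAt (fun s => stdGaussianCDF (-(d s))) (-(stdGaussianPDF (d t) * d')) t := by
  have h := (hasDerivAt_stdGaussianCDF (-(d t))).comp t hd.neg
  rwa [stdGaussianPDF_neg, mul_neg] at h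

/-- The relation `d₋ = d₊ - √y`, valid for every `y` because both sides vanish for `y ≤ 0`. -/
theorem dMinus_eq_dPlus_sub_sqrt (K r T x y : ℝ) :
    dMinus K r T x y = dPlus K r T x y - Real.sqrt y := by
  rw [dMinus, dPlus]
  nth_rw 3 [← Real.div_sqrt (x := y)]
  ring

theorem strike_mul_stdGaussianPDF_dMinus {K x y : ℝ} (r T : ℝ) (hK : 0 < K) (hx : 0 < x)
    (hy : 0 < y) :
    K * Real.exp (-(r * T)) * stdGaussianPDF (dMinus K r T x y) =
      x * stdGaussianPDF (dPlus K r T x y) := by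
  have hexp : -dMinus K r T x y ^ 2 / 2 =
      -dPlus K r T x y ^ 2 / 2 + (Real.log (x / K) + r * T) := by
    rw [dMinus, dPlus, div_pow, div_pow, Real.sq_sqrt hy.le]
    field_simp
    ring
  rw [stdGaussianPDF, stdGaussianPDF, hexp, Real.exp_add, Real.exp_add,
    Real.exp_log (div_pos hx hK), Real.exp_neg]
  field_simp

theorem hasDerivAt_dPlus_spot {K x : ℝ} (r T y : ℝ) (hK : 0 < K) (hx : 0 < x) :
    HasDerivAt (fun x' => dPlus K r T x' y) (x⁻¹ / Real.sqrt y) x := by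
  have hlog : HasDerivAt (fun x' => Real.log (x' / K)) x⁻¹ x := by
    refine (((hasDerivAt_id x).div_const K).log (div_pos hx hK).ne').congr_deriv ?_
    simp only [id]
    field_simp
  exact ((hlog.add_const (r * T)).add_const (y / 2)).div_const (Real.sqrt y)

theorem differentiableAt_dPlus_variance (K r T x : ℝ) {y : ℝ} (hy : 0 < y) :
    DifferentiableAt ℝ (fun y' => dPlus K r T x y') y := by
  unfold dPlus
  exact DifferentiableAt.div (by fun_prop) (differentiableAt_id.sqrt hy.ne')
    (Real.sqrt_pos.2 hy).ne'

theorem hasDerivAt_BSPut_spot {K x y : ℝ} (r T : ℝ) (hK : 0 < K) (hx : 0 < x) (hy : 0 < y) :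
    HasDerivAt (fun x' => BSPut K r T x' y) (-stdGaussianCDF (-(dPlus K r T x y))) x := by
  have hp := hasDerivAt_dPlus_spot r T y hK hx
  have hm : HasDerivAt (fun x' => dMinus K r T x' y) (x⁻¹ / Real.sqrt y) x := by
    simpa only [dMinus_eq_dPlus_sub_sqrt] using hp.sub_const (Real.sqrt y)
  refine ((hm.stdGaussianCDF_neg.const_mul (K * Real.exp (-(r * T)))).sub
    ((hasDerivAt_id x).mul hp.stdGaussianCDF_neg)).congr_deriv ?_
  simp only [id]
  linear_combination
    -(x⁻¹ / Real.sqrt y) * strike_mul_stdGaussianPDF_dMinus r T hK hx hy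

theorem hasDerivAt_BSPut_variance {K x y : ℝ} (r T : ℝ) (hK : 0 < K) (hx : 0 < x)
    (hy : 0 < y) :
    HasDerivAt (fun y' => BSPut K r T x y')
      (x * stdGaussianPDF (dPlus K r T x y) / (2 * Real.sqrt y)) y := by
  have hp := (differentiableAt_dPlus_variance K r T x hy).hasDerivAt
  set p' := deriv (fun y' => dPlus K r T x y') y
  have hm : HasDerivAt (fun y' => dMinus K r T x y') (p' - 1 / (2 * Real.sqrt y)) y := by
    simp only [dMinus_eq_dPlus_sub_sqrt]
    exact hp.sub (Real.hasDerivAt_sqrt hy.ne')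
  refine ((hm.stdGaussianCDF_neg.const_mul (K * Real.exp (-(r * T)))).sub
    (hp.stdGaussianCDF_neg.const_mul x)).congr_deriv ?_
  linear_combination
    -(p' - 1 / (2 * Real.sqrt y)) * strike_mul_stdGaussianPDF_dMinus r T hK hx hy

/-- First-order partial derivatives of the Black–Scholes put price:
`∂BS_Put/∂x = −Φ(−d₊)` and `∂BS_Put/∂y = x·φ(d₊)/(2√y)` for all `x, y > 0`. -/
theorem bsPut_first_partials (K r T : ℝ) (hK : 0 < K) (hT : 0 < T) :
    ∀ x y : ℝ, 0 < x → 0 < y →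
      deriv (fun x' => BSPut K r T x' y) x = -stdGaussianCDF (-(dPlus K r T x y)) ∧
      deriv (fun y' => BSPut K r T x y') y =
        x * stdGaussianPDF (dPlus K r T x y) / (2 * Real.sqrt y) := by
  intro x y hx hy
  exact ⟨(hasDerivAt_BSPut_spot r T hK hx hy).deriv,
    (hasDerivAt_BSPut_variance r T hK hx hy).deriv⟩
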